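/- Lemma (tori): Let p, q ≥ 4 and let G = C_p □ C_q be the torus. Then for every T ⊆ V(G) satisfying conditions P, S and S̄, G admits an acyclic T-odd orientation. -/

import Mathlib

open SimpleGraph

section Defs

variable {V : Type*}

/-- An orientation of a simple graph: each edge gets exactly one direction. -/
structure GraphOrientation {V : Type*} (G : SimpleGraph V) where
  dir : V → V → Prop
  dir_adj : ∀ u v, dir u v → G.Adj u v
  dir_choice : ∀ u v, G.Adj u v → (dir u v ↔ ¬ dir v u)

/-- An orientation is acyclic if there is no directed cycle, i.e. the transitive
closure of the arc relation is irreflexive. -/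
def GraphOrientation.Acyclic {G : SimpleGraph V} (o : GraphOrientation G) : Prop :=
  Irreflexive (Relation.TransGen o.dir)

/-- In-degree of a vertex in an orientation. -/
noncomputable def GraphOrientation.indeg {G : SimpleGraph V} (o : GraphOrientation G)
    (v : V) : ℕ :=
  Set.ncard {u | o.dir u v}

/-- An orientation is `T`-odd if a vertex has odd in-degree iff it belongs to `T`. -/
def GraphOrientation.IsTOdd {G : SimpleGraph V} (o : GraphOrientation G) (T : Set V) : Prop :=
  ∀ v, Odd (o.indeg v) ↔ v ∈ T

/-- `G` admits an acyclic `T`-odd orientation. -/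
def HasAcyclicTOddOrientation (G : SimpleGraph V) (T : Set V) : Prop :=
  ∃ o : GraphOrientation G, o.Acyclic ∧ o.IsTOdd T

/-- Degree of a vertex. -/
noncomputable def vdeg (G : SimpleGraph V) (v : V) : ℕ := (G.neighborSet v).ncard

/-- Potential sources: `V \ T`. -/
def sourceSet (T : Set V) : Set V := Tᶜ

/-- Potential sinks. -/
def sinkSet (G : SimpleGraph V) (T : Set V) : Set V :=
  {v | (v ∈ T ∧ Odd (vdeg G v)) ∨ (v ∉ T ∧ Even (vdeg G v))}

/-- Parity condition `𝒫`: `|E| + |T|` is even. -/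
def CondP (G : SimpleGraph V) (T : Set V) : Prop :=
  Even (G.edgeSet.ncard + T.ncard)

/-- Source condition `𝒮`. -/
def CondS (G : SimpleGraph V) (T : Set V) : Prop :=
  (sourceSet T).Nonempty ∧
    ((sourceSet T).ncard = 1 → Nat.card V = 1 ∨ sourceSet T ≠ sinkSet G T)

/-- Sink condition `𝒮̄`. -/
def CondSbar (G : SimpleGraph V) (T : Set V) : Prop :=
  (sinkSet G T).Nonempty ∧
    ((sinkSet G T).ncard = 1 → Nat.card V = 1 ∨ sinkSet G T ≠ sourceSet T)

/-- Membership in the class `C_P`. -/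
def MemCP (G : SimpleGraph V) : Prop :=
  ∀ T : Set V, CondP G T → HasAcyclicTOddOrientation G T

/-- Membership in the class `C_{P,S}`. -/
def MemCPS (G : SimpleGraph V) : Prop :=
  ∀ T : Set V, CondP G T → CondS G T → HasAcyclicTOddOrientation G T

/-- Membership in the class `C_{P,S̄}`. -/
def MemCPSbar (G : SimpleGraph V) : Prop :=
  ∀ T : Set V, CondP G T → CondSbar G T → HasAcyclicTOddOrientation G T

/-- Membership in the class `C_{P,S,S̄}`. -/
def MemCPSSbar (G : SimpleGraph V) : Prop :=
  ∀ T : Set V, CondP G T → CondS G T → CondSbar G T → HasAcyclicTOddOrientation G T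

/-- A graph is Eulerian if it is connected and every vertex has even degree. -/
def IsEulerianGraph (G : SimpleGraph V) : Prop :=
  G.Connected ∧ ∀ v : V, Even (vdeg G v)

end Defs

/-- Successor of `i` on the cycle `0, …, n - 1`. -/
def cycNext (n i : ℕ) : ℕ := if i + 1 = n then 0 else i + 1

/-- Predecessor of `i` on the cycle `0, …, n - 1`. -/
def cycPrev (n i : ℕ) : ℕ := if i = 0 then n - 1 else i - 1

/-- The number of torus neighbours of `(i, j)` with larger `f`-value. -/
def upDegree (p q : ℕ) (f : ℕ → ℕ → ℕ) (i j : ℕ) : ℕ :=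
  (if f i j < f (cycNext p i) j then 1 else 0) + (if f i j < f (cycPrev p i) j then 1 else 0) +
  ((if f i j < f i (cycNext q j) then 1 else 0) + (if f i j < f i (cycPrev q j) then 1 else 0))

/-- Adjacent vertices have distinct `f`-values, `(0, 0)` and `b` are local minima, and every
vertex other than these two and `z` has odd `upDegree`; stated at the vertex `(i, j)`. -/
def IsPeelingAt (p q : ℕ) (b z : ℕ × ℕ) (f : ℕ → ℕ → ℕ) (i j : ℕ) : Prop :=
  f i j ≠ f (cycNext p i) j ∧ f i j ≠ f i (cycNext q j) ∧
    (((i = 0 ∧ j = 0) ∨ (i = b.1 ∧ j = b.2)) →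
      f i j < f (cycNext p i) j ∧ f i j < f (cycPrev p i) j ∧
      f i j < f i (cycNext q j) ∧ f i j < f i (cycPrev q j)) ∧
    (¬ ((i = 0 ∧ j = 0) ∨ (i = b.1 ∧ j = b.2)) → ¬ (i = z.1 ∧ j = z.2) →
      upDegree p q f i j % 2 = 1)

instance (p q : ℕ) (b z : ℕ × ℕ) (f : ℕ → ℕ → ℕ) (i j : ℕ) :
    Decidable (IsPeelingAt p q b z f i j) := by
  unfold IsPeelingAt; infer_instance

/-- `f` ranks the vertices of the `p × q` torus so that, removing them in increasing order, all
but `(0, 0)`, `b` and `z` have an odd number of remaining neighbours. -/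
def IsPeeling (p q : ℕ) (b z : ℕ × ℕ) (f : ℕ → ℕ → ℕ) : Prop :=
  ∀ i < p, ∀ j < q, IsPeelingAt p q b z f i j

/-- The `p × q` torus has a peeling with local minima `(0, 0)` and `b`. -/
def HasPeeling (p q : ℕ) (b : ℕ × ℕ) : Prop := ∃ z f, IsPeeling p q b z f

lemma cycPrev_lt {n i : ℕ} (h : i < n) : cycPrev n i < n := by
  unfold cycPrev; split_ifs <;> omega

lemma cycNext_cycPrev {n i : ℕ} (h : i < n) : cycNext n (cycPrev n i) = i := by
  unfold cycNext cycPrev; split_ifs <;> omega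

lemma HasPeeling.swap {p q : ℕ} {b : ℕ × ℕ} (h : HasPeeling p q b) :
    HasPeeling q p b.swap := by
  obtain ⟨z, f, h⟩ := h
  refine ⟨z.swap, fun i j => f j i, fun i hi j hj => ?_⟩
  obtain ⟨h1, h2, h3, h4⟩ := h j hj i hi
  refine ⟨h2, h1, fun hb => ?_, fun hb hz => ?_⟩
  · obtain ⟨a, b, c, d⟩ := h3 (by simpa [and_comm] using hb)
    exact ⟨c, d, a, b⟩
  · have := h4 (by simpa [and_comm] using hb) (by simpa [and_comm] using hz)
    simp only [upDegree] at this ⊢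
    omega

lemma HasPeeling.insert {p q b₁ b₂ k : ℕ} (h : HasPeeling p q (b₁, b₂)) (hk : k < p) :
    HasPeeling (p + 2) q (if b₁ ≤ k then b₁ else b₁ + 2, b₂) := by
  obtain ⟨z, f, h⟩ := h
  let π : ℕ → ℕ := fun i => if i ≤ k then i else if i ≤ k + 2 then k else i - 2
  let V : ℕ → ℕ := fun j =>
    (if f k j < f k (cycNext q j) then 1 else 0) + (if f k j < f k (cycPrev q j) then 1 else 0)
  let off : ℕ → ℕ → ℕ := fun i j =>
    if f k j < f (cycNext p k) j then
      if V j % 2 = 0 then (if i = k + 1 then 1 else if i = k + 2 then 2 else 0)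
      else (if i = k + 1 then 1 else 0)
    else
      if V j % 2 = 0 then (if i = k then 2 else if i = k + 1 then 1 else 0)
      else (if i = k then 1 else if i = k + 2 then 1 else 0)
  have hoff : ∀ i j, off i j < 4 := by intro i j; simp only [off]; split_ifs <;> omega
  have hne : ∀ i < p, ∀ j < q, f i j ≠ f (cycNext p i) j ∧ f i j ≠ f (cycPrev p i) j ∧
      f i j ≠ f i (cycNext q j) ∧ f i j ≠ f i (cycPrev q j) := by
    intro i hi j hj
    have h1 := (h (cycPrev p i) (cycPrev_lt hi) j hj).1
    have h2 := (h i hi (cycPrev q j) (cycPrev_lt hj)).2.1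
    rw [cycNext_cycPrev hi] at h1
    rw [cycNext_cycPrev hj] at h2
    exact ⟨(h i hi j hj).1, h1.symm, (h i hi j hj).2.1, h2.symm⟩
  obtain ⟨F, hF⟩ : ∃ F : ℕ → ℕ → ℕ, ∀ i j, F i j = 4 * f (π i) j + off i j :=
    ⟨_, fun _ _ => rfl⟩
  refine ⟨(if z.1 ≤ k then z.1 else z.1 + 2, z.2), F, fun i hi j hj => ?_⟩
  have key : ∀ i' j' i'' j'', f (π i') j' ≠ f (π i'') j'' →
      ((F i' j' < F i'' j'' ↔ f (π i') j' < f (π i'') j'') ∧ F i' j' ≠ F i'' j'') := by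
    intro i' j' i'' j'' hn
    rw [hF, hF]
    have := hoff i' j'
    have := hoff i'' j''
    omega
  have hπ : π i < p := by simp only [π]; split_ifs <;> omega
  unfold IsPeelingAt
  dsimp only
  obtain ⟨n1, n2, n3, n4⟩ := hne (π i) hπ j hj
  obtain ⟨-, -, h3, h4⟩ := h (π i) hπ j hj
  obtain ⟨v1, v1'⟩ := key i j i (cycNext q j) n3
  obtain ⟨v2, v2'⟩ := key i j i (cycPrev q j) n4
  have hπx : i ≠ k + 1 → i ≠ k + 2 → ∀ x, i = (if x ≤ k then x else x + 2) ↔ π i = x := by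
    intro _ _ x
    simp only [π]; split_ifs <;> omega
  have hπ0 : i ≠ k + 1 → i ≠ k + 2 → (i = 0 ↔ π i = 0) := by
    intro _ _
    simp only [π]; split_ifs <;> omega
  by_cases hik : i < k ∨ k + 2 < i
  · have e1 : π (cycNext (p + 2) i) = cycNext p (π i) := by
      simp only [π, cycNext]; split_ifs <;> omega
    have e2 : π (cycPrev (p + 2) i) = cycPrev p (π i) := by
      simp only [π, cycPrev]; split_ifs <;> omega
    obtain ⟨w1, w1'⟩ := key i j (cycNext (p + 2) i) j (by rwa [e1])
    rw [e1] at w1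
    obtain ⟨w2, w2'⟩ := key i j (cycPrev (p + 2) i) j (by rwa [e2])
    rw [e2] at w2
    rw [hπx (by omega) (by omega), hπ0 (by omega) (by omega)]
    refine ⟨w1', v1', fun hb => ?_, fun hb => ?_⟩
    · simpa only [w1, v1, v2, w2] using h3 hb
    · rw [hπx (by omega) (by omega)]
      simpa only [upDegree, w1, v1, v2, w2] using h4 hb
  have hi' : i = k ∨ i = k + 1 ∨ i = k + 2 := by omega
  obtain ⟨m1, -, -, -⟩ := hne k hk j hj
  have hVdef : V j = (if f k j < f k (cycNext q j) then 1 else 0) +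
    (if f k j < f k (cycPrev q j) then 1 else 0) := rfl
  have πk : π k = k := by simp [π]
  have πk1 : π (k + 1) = k := by simp [π]
  have πk2 : π (k + 2) = k := by simp [π]
  have nk : cycNext (p + 2) k = k + 1 := by simp only [cycNext]; split_ifs <;> omega
  have nk1 : cycNext (p + 2) (k + 1) = k + 2 := by simp only [cycNext]; split_ifs <;> omega
  have pk1 : cycPrev (p + 2) (k + 1) = k := by simp [cycPrev]
  have pk2 : cycPrev (p + 2) (k + 2) = k + 1 := by simp [cycPrev]
  have ok : off k j = if f k j < f (cycNext p k) j then 0 else if V j % 2 = 0 then 2 else 1 := by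
    simp [off]
  have ok1 : off (k + 1) j = if f k j < f (cycNext p k) j then 1
      else if V j % 2 = 0 then 1 else 0 := by
    simp [off]
  have ok2 : off (k + 2) j = if f k j < f (cycNext p k) j then (if V j % 2 = 0 then 2 else 0)
      else (if V j % 2 = 0 then 0 else 1) := by
    simp [off]
  rcases hi' with rfl | rfl | rfl
  · have e2 : π (cycPrev (p + 2) i) = cycPrev p (π i) := by
      simp only [π, cycPrev]; split_ifs <;> omega
    obtain ⟨w2, w2'⟩ := key i j (cycPrev (p + 2) i) j (by rwa [e2])
    rw [e2] at w2
    have w1 : (F i j < F (cycNext (p + 2) i) j ↔ f (π i) j < f (cycNext p (π i)) j) ∧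
        F i j ≠ F (cycNext (p + 2) i) j := by
      rw [hF, hF, nk, πk, πk1, ok, ok1]
      split_ifs <;> omega
    rw [hπx (by omega) (by omega), hπ0 (by omega) (by omega)]
    refine ⟨w1.2, v1', fun hb => ?_, fun hb => ?_⟩
    · simpa only [w1.1, v1, v2, w2] using h3 hb
    · rw [hπx (by omega) (by omega)]
      simpa only [upDegree, w1.1, v1, v2, w2] using h4 hb
  · refine ⟨?_, v1', fun hb => ?_, fun _ _ => ?_⟩
    · rw [hF, hF, nk1, πk1, πk2, ok1, ok2]
      split_ifs <;> omega
    · exfalso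
      obtain ⟨hb, -⟩ | ⟨hb, -⟩ := hb
      · omega
      · split_ifs at hb <;> omega
    · simp only [upDegree, v1, v2]
      simp only [nk1, pk1, hF, πk, πk1, πk2, ok, ok1, ok2, ← hVdef]
      split_ifs <;> omega
  · have e1 : π (cycNext (p + 2) (k + 2)) = cycNext p k := by
      simp only [π, cycNext]; split_ifs <;> omega
    rw [πk2] at n1
    obtain ⟨w1, w1'⟩ := key (k + 2) j (cycNext (p + 2) (k + 2)) j (by rwa [e1, πk2])
    refine ⟨w1', v1', fun hb => ?_, fun _ _ => ?_⟩
    · exfalso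
      obtain ⟨hb, -⟩ | ⟨hb, -⟩ := hb
      · omega
      · split_ifs at hb <;> omega
    · simp only [upDegree, v1, v2, w1]
      simp only [e1, pk2, hF, πk1, πk2, ok1, ok2, ← hVdef]
      split_ifs <;> omega

lemma HasPeeling.grow_right {p q b₁ b₂ : ℕ} (h : HasPeeling p q (b₁, b₂)) (hb : b₁ < p) (t : ℕ) :
    HasPeeling (p + 2 * t) q (b₁, b₂) := by
  induction t with
  | zero => exact h
  | succ t ih =>
    have := ih.insert (k := b₁) (by omega)
    rwa [if_pos le_rfl] at this

lemma HasPeeling.grow_left {p q b₁ b₂ : ℕ} (h : HasPeeling p q (b₁, b₂)) (hb : 0 < b₁)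
    (hp : 0 < p) (s : ℕ) : HasPeeling (p + 2 * s) q (b₁ + 2 * s, b₂) := by
  induction s with
  | zero => exact h
  | succ s ih =>
    have := ih.insert (k := 0) (by omega)
    rwa [if_neg (by omega)] at this

/-- The function with the given table of values. -/
def tableFun (L : List (List ℕ)) (i j : ℕ) : ℕ := (L.getD i []).getD j 0

instance (p q : ℕ) (b z : ℕ × ℕ) (f : ℕ → ℕ → ℕ) : Decidable (IsPeeling p q b z f) := by
  unfold IsPeeling; infer_instance

lemma hasPeeling_four_three : HasPeeling 4 3 (0, 0) :=
  ⟨(3, 2), tableFun [[0, 1, 4], [2, 5, 3], [6, 8, 9], [10, 7, 11]], by decide⟩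

lemma hasPeeling_four_four : HasPeeling 4 4 (0, 0) :=
  ⟨(3, 3), tableFun [[0, 1, 2, 9], [3, 5, 4, 8], [6, 11, 12, 7], [13, 10, 14, 15]], by decide⟩

lemma hasPeeling_three_three {b₁ b₂ : ℕ} (h₁ : b₁ = 1 ∨ b₁ = 2) (h₂ : b₂ = 1 ∨ b₂ = 2) :
    HasPeeling 3 3 (b₁, b₂) := by
  rcases h₁ with rfl | rfl <;> rcases h₂ with rfl | rfl
  · exact ⟨(2, 2), tableFun [[0, 3, 2], [5, 1, 6], [4, 7, 8]], by decide⟩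
  · exact ⟨(2, 2), tableFun [[0, 2, 3], [5, 6, 1], [4, 7, 8]], by decide⟩
  · exact ⟨(2, 2), tableFun [[0, 3, 2], [4, 5, 6], [7, 1, 8]], by decide⟩
  · exact ⟨(2, 1), tableFun [[0, 2, 3], [4, 6, 5], [7, 8, 1]], by decide⟩

lemma hasPeeling_five_three {b : ℕ} (h : b = 2 ∨ b = 3) : HasPeeling 5 3 (b, 0) := by
  rcases h with rfl | rfl
  · exact ⟨(4, 2), tableFun [[0, 2, 7], [4, 3, 6], [1, 8, 5], [9, 11, 12], [13, 10, 14]],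
      by decide⟩
  · exact ⟨(4, 2), tableFun [[0, 2, 5], [3, 6, 4], [8, 7, 9], [1, 11, 12], [13, 10, 14]],
      by decide⟩

lemma hasPeeling_of_even_left {p q : ℕ} (hp : 4 ≤ p) (hq : 4 ≤ q) (h : Even p) :
    HasPeeling p q (0, 0) := by
  have h0 : ∃ r, (r = 3 ∨ r = 4) ∧ ∃ t, q = r + 2 * t := by
    rcases Nat.even_or_odd' q with ⟨t, ht | ht⟩
    · exact ⟨4, by simp, t - 2, by omega⟩
    · exact ⟨3, by simp, t - 1, by omega⟩
  obtain ⟨r, hr, t, rfl⟩ := h0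
  obtain ⟨s, rfl⟩ := h
  have base : HasPeeling 4 r (0, 0) := by
    rcases hr with rfl | rfl
    · exact hasPeeling_four_three
    · exact hasPeeling_four_four
  have := ((base.swap.grow_right (by omega) t).swap.grow_right (by omega) (s - 2))
  rwa [show 4 + 2 * (s - 2) = s + s by omega] at this

lemma hasPeeling_of_even {p q : ℕ} (hp : 4 ≤ p) (hq : 4 ≤ q) (h : Even (p * q)) :
    HasPeeling p q (0, 0) := by
  rcases Nat.even_mul.1 h with h | h
  · exact hasPeeling_of_even_left hp hq h
  · exact (hasPeeling_of_even_left hq hp h).swap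

/-- Positions on an odd cycle reduce, two vertices at a time, to positions on a shorter one. -/
lemma exists_reduction {p b m : ℕ} (hp : Odd p) (hm : 2 ≤ m) (hb : m - 1 ≤ b)
    (hbp : b + (m - 1) ≤ p) : ∃ c s t, (c = m - 1 ∨ c = m) ∧ b = c + 2 * s ∧
      p = 2 * m - 1 + 2 * s + 2 * t := by
  obtain ⟨r, rfl⟩ := hp
  rcases Nat.even_or_odd' (b - (m - 1)) with ⟨s, hs | hs⟩
  · exact ⟨m - 1, s, r + 1 - m - s, by simp, by omega, by omega⟩
  · exact ⟨m, s, r + 1 - m - s, by simp, by omega, by omega⟩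

lemma HasPeeling.grow {p q b₁ b₂ : ℕ} (h : HasPeeling p q (b₁, b₂)) (hb : 0 < b₁)
    (hbp : b₁ < p) (s t : ℕ) : HasPeeling (p + 2 * s + 2 * t) q (b₁ + 2 * s, b₂) :=
  (h.grow_left hb (by omega) s).grow_right (by omega) t

lemma hasPeeling_row {p q b : ℕ} (hp : Odd p) (hq : Odd q) (hq3 : 3 ≤ q) (hb : 2 ≤ b)
    (hbp : b + 2 ≤ p) : HasPeeling p q (b, 0) := by
  obtain ⟨c, s, t, hc, rfl, rfl⟩ := exists_reduction (m := 3) hp (by omega) hb hbp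
  obtain ⟨r, rfl⟩ := hq
  have base := (hasPeeling_five_three hc).swap.grow_right (by simp) (r - 1)
  rw [show 3 + 2 * (r - 1) = 2 * r + 1 by omega] at base
  exact base.swap.grow (by simp only; omega) (by simp only; omega) s t

/-- On an odd torus, `(0, 0)` and any vertex different from and not adjacent to it can be
made local minima of a peeling. -/
lemma hasPeeling_of_odd {p q b₁ b₂ : ℕ} (hp : Odd p) (hq : Odd q) (hp3 : 3 ≤ p) (hq3 : 3 ≤ q)
    (h₁ : b₁ < p) (h₂ : b₂ < q)
    (hr : b₁ = 0 → 2 ≤ b₂ ∧ b₂ + 2 ≤ q) (hc : b₂ = 0 → 2 ≤ b₁ ∧ b₁ + 2 ≤ p) :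
    HasPeeling p q (b₁, b₂) := by
  rcases Nat.eq_zero_or_pos b₁ with rfl | hb₁
  · exact (hasPeeling_row hq hp hp3 (hr rfl).1 (hr rfl).2).swap
  rcases Nat.eq_zero_or_pos b₂ with rfl | hb₂
  · exact hasPeeling_row hp hq hq3 (hc rfl).1 (hc rfl).2
  obtain ⟨c, s, t, hc', rfl, rfl⟩ := exists_reduction (m := 2) hp le_rfl hb₁ h₁
  obtain ⟨d, s', t', hd, rfl, rfl⟩ := exists_reduction (m := 2) hq le_rfl hb₂ h₂
  have base := (hasPeeling_three_three hc' hd).swap.grow (by simp only; omega)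
    (by simp only; omega) s' t'
  exact base.swap.grow (by simp only; omega) (by simp only; omega) s t

section Flip

variable {V : Type*} [Fintype V]

/-- In an orientation in which all in-degrees but that of `z` are known to have the parity
prescribed by `T`, condition `𝒫` forces the parity of the in-degree of `z`. -/
lemma GraphOrientation.isTOdd_of_ne {G : SimpleGraph V} {T : Set V} (o : GraphOrientation G)
    (hP : CondP G T) (z : V) (h : ∀ v, v ≠ z → (Odd (o.indeg v) ↔ v ∈ T)) : o.IsTOdd T := by
  classical
  have hin : ∀ v, o.indeg v = ∑ u, if o.dir u v then 1 else 0 := by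
    intro v
    rw [Finset.sum_boole, GraphOrientation.indeg, Set.ncard_eq_toFinset_card']
    simp
  have hsum : ∑ v, o.indeg v = G.edgeSet.ncard := by
    have h1 := G.sum_degrees_eq_twice_card_edges
    have h2 : ∀ v, G.degree v = (∑ u, if o.dir u v then 1 else 0) +
        ∑ u, if o.dir v u then 1 else 0 := by
      intro v
      rw [← Finset.sum_add_distrib, ← G.card_neighborFinset_eq_degree, Finset.card_eq_sum_ones,
        G.neighborFinset_eq_filter, Finset.sum_filter]
      refine Finset.sum_congr rfl fun u _ => ?_
      have c1 := o.dir_choice u v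
      have c2 := o.dir_adj u v
      have c3 := o.dir_adj v u
      rw [G.adj_comm] at c1 c2
      by_cases ha : G.Adj v u
      · by_cases hd : o.dir u v <;> simp_all
      · simp_all
    rw [Finset.sum_congr rfl fun v _ => h2 v, Finset.sum_add_distrib,
      Finset.sum_comm (f := fun v u => if o.dir v u then 1 else 0), ← two_mul] at h1
    rw [Finset.sum_congr rfl fun v _ => hin v, Set.ncard_eq_toFinset_card']
    simpa [SimpleGraph.edgeFinset] using h1
  have hT : ∑ v, (if v ∈ T then 1 else 0) = T.ncard := by
    rw [Finset.sum_boole, Set.ncard_eq_toFinset_card']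
    simp
  have heven : Even (∑ v, (o.indeg v + if v ∈ T then 1 else 0)) := by
    rw [Finset.sum_add_distrib, hsum, hT]
    exact hP
  have hv : ∀ v, Even (o.indeg v + if v ∈ T then 1 else 0) ↔ (Odd (o.indeg v) ↔ v ∈ T) := by
    intro v
    split_ifs with hvT <;> simp [hvT, Nat.even_add_one]
  intro v
  by_cases hvz : v = z
  · subst hvz
    rw [← hv]
    rw [← Finset.add_sum_erase _ _ (Finset.mem_univ v)] at heven
    refine (Nat.even_add.1 heven).2 (Finset.even_sum _ fun u hu => ?_)
    exact (hv u).2 (h u (Finset.ne_of_mem_erase hu))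
  · exact h v hvz

/-- Given a ranking of the vertices such that removing them in increasing order, every vertex
outside `A ∪ {z}` has an odd number of remaining neighbours, while those of `A` lie outside `T`
and are removed before their neighbours, an acyclic `T`-odd orientation arises by removing each
vertex either as a source or as a sink. -/
lemma hasAcyclicTOddOrientation_of_rank (G : SimpleGraph V) (T A : Set V) (hP : CondP G T)
    (F : V → ℕ) (z : V) (hF : ∀ u v, G.Adj u v → F u ≠ F v)
    (hA : ∀ a ∈ A, a ∉ T ∧ ∀ w, G.Adj a w → F a < F w)
    (hodd : ∀ v, v ∉ A → v ≠ z → Odd {w | G.Adj v w ∧ F v < F w}.ncard) :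
    HasAcyclicTOddOrientation G T := by
  classical
  obtain ⟨X, hX⟩ : ∃ X : V → Prop,
      ∀ v, X v ↔ (Odd {u | F u < F v ∧ G.Adj u v ∧ X u}.ncard ↔ v ∈ T) := by
    have wf : WellFounded fun u v : V => F u < F v := (measure F).wf
    refine ⟨wf.fix fun v ih => (Odd {u | ∃ h : F u < F v, G.Adj u v ∧ ih u h}.ncard ↔ v ∈ T),
      fun v => ?_⟩
    rw [wf.fix_eq]
    simp only [exists_prop]
  let o : GraphOrientation G :=
    { dir := fun u v => G.Adj u v ∧ (F u < F v ∧ X u ∨ F v < F u ∧ ¬ X v)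
      dir_adj := fun u v h => h.1
      dir_choice := by
        intro u v h
        have := hF u v h
        rcases lt_or_gt_of_ne this with h1 | h1
        · by_cases hx : X u <;> simp [h, h.symm, h1, h1.not_gt, hx]
        · by_cases hx : X v <;> simp [h, h.symm, h1, h1.not_gt, hx] }
  refine ⟨o, ?_, o.isTOdd_of_ne hP z fun v hvz => ?_⟩
  · obtain ⟨N, hN⟩ : ∃ N : ℕ, ∀ v, F v < N :=
      ⟨∑ u, F u + 1, fun v => Nat.lt_succ_of_le
        (Finset.single_le_sum (fun _ _ => Nat.zero_le _) (Finset.mem_univ v))⟩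
    let g : V → ℤ := fun v => if X v then F v - N else N - F v
    have hg : ∀ u v, o.dir u v → g u < g v := by
      rintro u v ⟨-, ⟨h1, h2⟩ | ⟨h1, h2⟩⟩ <;> have := hN u <;> have := hN v <;>
        simp only [g, h2, if_true, if_false] <;> split_ifs <;> omega
    intro v hv
    have : ∀ w, Relation.TransGen o.dir v w → g v < g w := by
      intro w hw
      induction hw with
      | single h => exact hg _ _ h
      | tail _ h ih => exact ih.trans (hg _ _ h)
    exact lt_irrefl _ (this v hv)
  · have hXv := hX v
    by_cases hvA : v ∈ A
    · obtain ⟨hvT, hlt⟩ := hA v hvA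
      have hempty : {u | F u < F v ∧ G.Adj u v ∧ X u} = ∅ := by
        ext u
        simp only [Set.mem_ofPred_eq, Set.mem_empty_iff_false, iff_false]
        exact fun h => (hlt u h.2.1.symm).not_gt h.1
      have hx : X v := by rw [hXv, hempty]; simp [hvT]
      have : o.indeg v = 0 := by
        have : {u | o.dir u v} = ∅ := by
          ext u
          simp only [Set.mem_ofPred_eq, Set.mem_empty_iff_false, iff_false]
          rintro ⟨h, ⟨h1, -⟩ | ⟨-, h2⟩⟩
          · exact (hlt u h.symm).not_gt h1
          · exact h2 hx
        rw [GraphOrientation.indeg, this, Set.ncard_empty]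
      simp [this, hvT]
    · by_cases hx : X v
      · rw [← hXv.1 hx, GraphOrientation.indeg]
        have : {u | o.dir u v} = {u | F u < F v ∧ G.Adj u v ∧ X u} := by
          ext u
          simp only [Set.mem_ofPred_eq, o, hx]
          tauto
        rw [this]
      · have hout := hodd v hvA hvz
        have hsplit : {u | o.dir u v} =
            {u | F u < F v ∧ G.Adj u v ∧ X u} ∪ {w | G.Adj v w ∧ F v < F w} := by
          ext u
          simp only [Set.mem_ofPred_eq, Set.mem_union, o, hx, G.adj_comm v u]
          tauto
        have hdisj : Disjoint {u | F u < F v ∧ G.Adj u v ∧ X u}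
            {w | G.Adj v w ∧ F v < F w} := by
          rw [Set.disjoint_left]
          exact fun u h1 h2 => h1.1.not_gt h2.2
        rw [GraphOrientation.indeg, hsplit, Set.ncard_union_eq hdisj, Nat.odd_add]
        rw [hXv] at hx
        rw [← Nat.not_odd_iff_even]
        tauto

end Flip

lemma ncard_boxProd_cycleGraph {p q : ℕ} (hp : 3 ≤ p) (hq : 3 ≤ q) [NeZero p] [NeZero q]
    (v : Fin p × Fin q) (P : Fin p × Fin q → Prop) [DecidablePred P] :
    {w | (cycleGraph p □ cycleGraph q).Adj v w ∧ P w}.ncard =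
      (if P (v.1 + 1, v.2) then 1 else 0) + (if P (v.1 - 1, v.2) then 1 else 0) +
      ((if P (v.1, v.2 + 1) then 1 else 0) + (if P (v.1, v.2 - 1) then 1 else 0)) := by
  classical
  have hne : ∀ {n : ℕ} [NeZero n] (_ : 3 ≤ n) (x : Fin n), x - 1 ≠ x + 1 := by
    intro n _ hn x
    obtain ⟨k, rfl⟩ := Nat.exists_eq_add_of_le' hn
    simp only [ne_eq, sub_eq_iff_eq_add, add_assoc x, left_eq_add]
    exact ne_of_beq_false rfl
  have hnb : ∀ {n : ℕ} [NeZero n] (_ : 3 ≤ n) (x : Fin n),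
      (cycleGraph n).neighborFinset x = {x - 1, x + 1} := by
    intro n _ hn x
    obtain ⟨k, rfl⟩ := Nat.exists_eq_add_of_le' hn
    convert cycleGraph_neighborFinset (n := k + 1) (v := x)
  have hset : {w | (cycleGraph p □ cycleGraph q).Adj v w ∧ P w} =
      (((cycleGraph p □ cycleGraph q).neighborFinset v).filter P : Finset _) := by
    ext w; simp
  rw [hset, Set.ncard_coe_finset, Finset.card_filter, neighborFinset_boxProd,
    Finset.sum_disjUnion, Finset.sum_product, Finset.sum_product, Finset.sum_singleton,
    hnb hp, hnb hq, Finset.sum_pair (hne hp v.1), Finset.sum_pair (hne hq v.2)]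
  simp only [Finset.sum_singleton]
  omega

lemma val_add_one_sub {n : ℕ} [NeZero n] (hn : 2 ≤ n) (x c : Fin n) :
    (x + 1 - c).val = cycNext n (x - c).val := by
  obtain ⟨k, rfl⟩ := Nat.exists_eq_add_of_le' hn
  rw [add_sub_right_comm, Fin.val_add_one, cycNext]
  simp only [Fin.ext_iff, Fin.val_last]
  split_ifs <;> omega

lemma val_sub_one_sub {n : ℕ} [NeZero n] (hn : 2 ≤ n) (x c : Fin n) :
    (x - 1 - c).val = cycPrev n (x - c).val := by
  obtain ⟨k, rfl⟩ := Nat.exists_eq_add_of_le' hn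
  rw [sub_right_comm, Fin.coe_sub_one, cycPrev]
  simp only [Fin.ext_iff, Fin.val_zero]
  split_ifs <;> omega

lemma boxProd_cycleGraph_adj_iff {p q : ℕ} (hp : 2 ≤ p) (hq : 2 ≤ q) [NeZero p] [NeZero q]
    (v w : Fin p × Fin q) : (cycleGraph p □ cycleGraph q).Adj v w ↔
      w = (v.1 + 1, v.2) ∨ w = (v.1 - 1, v.2) ∨ w = (v.1, v.2 + 1) ∨ w = (v.1, v.2 - 1) := by
  have h : ∀ {n : ℕ} [NeZero n] (_ : 2 ≤ n) (x y : Fin n),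
      (cycleGraph n).Adj x y ↔ y = x + 1 ∨ y = x - 1 := by
    intro n _ hn x y
    obtain ⟨k, rfl⟩ := Nat.exists_eq_add_of_le' hn
    have h1 : x - y = 1 ↔ y = x - 1 := by
      constructor <;> intro h
      · rw [← h]; abel
      · rw [h]; abel
    have h2 : y - x = 1 ↔ y = x + 1 := by rw [sub_eq_iff_eq_add, add_comm 1 x]
    rw [cycleGraph_adj, h1, or_comm]
    exact or_congr_left h2
  rw [boxProd_adj, h hp, h hq]
  simp only [Prod.ext_iff]
  tauto

lemma hasAcyclicTOddOrientation_of_hasPeeling {p q : ℕ} (hp : 3 ≤ p) (hq : 3 ≤ q)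
    {T : Set (Fin p × Fin q)} (hP : CondP (cycleGraph p □ cycleGraph q) T)
    {a b : Fin p × Fin q} (ha : a ∉ T) (hb : b ∉ T)
    (h : HasPeeling p q ((b.1 - a.1).val, (b.2 - a.2).val)) :
    HasAcyclicTOddOrientation (cycleGraph p □ cycleGraph q) T := by
  have : NeZero p := ⟨by omega⟩
  have : NeZero q := ⟨by omega⟩
  obtain ⟨z, f, h⟩ := h
  let F : Fin p × Fin q → ℕ := fun v => f (v.1 - a.1).val (v.2 - a.2).val
  have h' := fun v : Fin p × Fin q => h _ (v.1 - a.1).isLt _ (v.2 - a.2).isLt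
  have hsub : ∀ {n : ℕ} [NeZero n] (x y c : Fin n), (x - c).val = (y - c).val → x = y :=
    fun x y c hxy => sub_left_injective (Fin.ext hxy)
  have hcond : ∀ v : Fin p × Fin q, ((v.1 - a.1).val = 0 ∧ (v.2 - a.2).val = 0 ∨
      (v.1 - a.1).val = (b.1 - a.1).val ∧ (v.2 - a.2).val = (b.2 - a.2).val) ↔
      v ∈ ({a, b} : Set (Fin p × Fin q)) := by
    intro v
    simp only [Set.mem_insert_iff, Set.mem_singleton_iff, Prod.ext_iff, Fin.val_eq_zero_iff,
      sub_eq_zero, Fin.val_inj, sub_left_inj]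
  refine hasAcyclicTOddOrientation_of_rank _ T {a, b} hP F
    (a.1 + Fin.ofNat p z.1, a.2 + Fin.ofNat q z.2) ?_ ?_ ?_
  · intro u v huv
    have h1 := (h' u).1
    have h2 := (h' u).2.1
    have h3 := (h' v).1
    have h4 := (h' v).2.1
    rw [← val_add_one_sub (by omega)] at h1 h2 h3 h4
    rcases (boxProd_cycleGraph_adj_iff (by omega) (by omega) _ _).1 huv with
      rfl | rfl | rfl | rfl
    · exact h1
    · simpa [F] using h3.symm
    · exact h2
    · simpa [F] using h4.symm
  · intro v hv
    refine ⟨?_, fun w hw => ?_⟩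
    · rcases hv with rfl | rfl
      · exact ha
      · exact hb
    · obtain ⟨h1, h2, h3, h4⟩ := (h' v).2.2.1 ((hcond v).2 hv)
      rw [← val_add_one_sub (by omega)] at h1 h3
      rw [← val_sub_one_sub (by omega)] at h2 h4
      rcases (boxProd_cycleGraph_adj_iff (by omega) (by omega) _ _).1 hw with
        rfl | rfl | rfl | rfl <;> assumption
  · intro v hv hvz
    have hodd := (h' v).2.2.2 (by rwa [hcond]) (by
      rintro ⟨h1, h2⟩
      apply hvz
      rw [← h1, ← h2]
      ext <;> simp)
    rw [ncard_boxProd_cycleGraph hp hq, Nat.odd_iff]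
    simpa only [upDegree, F, val_add_one_sub (show 2 ≤ p by omega),
      val_add_one_sub (show 2 ≤ q by omega), val_sub_one_sub (show 2 ≤ p by omega),
      val_sub_one_sub (show 2 ≤ q by omega)] using hodd

lemma Fin.val_sub_eq_ite {n : ℕ} (x y : Fin n) :
    (x - y).val = if y.val ≤ x.val then x.val - y.val else n + x.val - y.val := by
  split_ifs with h
  · exact Fin.coe_sub_iff_le.2 h
  · exact Fin.coe_sub_iff_lt.2 (not_le.1 h)

lemma cycleGraph_not_triangle {n : ℕ} (hn : 4 ≤ n) {x y z : Fin n}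
    (h₁ : (cycleGraph n).Adj x y) (h₂ : (cycleGraph n).Adj x z) (h₃ : (cycleGraph n).Adj y z) :
    False := by
  rw [cycleGraph_adj', Fin.val_sub_eq_ite, Fin.val_sub_eq_ite] at h₁ h₂ h₃
  split_ifs at h₁ h₂ h₃ <;> omega

lemma boxProd_cycleGraph_not_triangle {p q : ℕ} (hp : 4 ≤ p) (hq : 4 ≤ q)
    {x y z : Fin p × Fin q} (h₁ : (cycleGraph p □ cycleGraph q).Adj x y)
    (h₂ : (cycleGraph p □ cycleGraph q).Adj x z) (h₃ : (cycleGraph p □ cycleGraph q).Adj y z) :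
    False := by
  rw [boxProd_adj] at h₁ h₂ h₃
  rcases h₁ with ⟨a₁, e₁⟩ | ⟨a₁, e₁⟩ <;> rcases h₂ with ⟨a₂, e₂⟩ | ⟨a₂, e₂⟩ <;>
    rcases h₃ with ⟨a₃, e₃⟩ | ⟨a₃, e₃⟩
  · exact cycleGraph_not_triangle hp a₁ a₂ a₃
  · exact a₃.ne (e₁.symm.trans e₂)
  · exact a₂.ne (e₁.trans e₃)
  · exact a₁.ne (e₂.trans e₃.symm)
  · exact a₁.ne (e₂.trans e₃.symm)
  · exact a₂.ne (e₁.trans e₃)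
  · exact a₃.ne (e₁.symm.trans e₂)
  · exact cycleGraph_not_triangle hq a₁ a₂ a₃

lemma hasPeeling_of_not_adj {p q : ℕ} (hp : Odd p) (hq : Odd q) (hp3 : 3 ≤ p) (hq3 : 3 ≤ q)
    {a b : Fin p × Fin q} (hab : a ≠ b) (h : ¬ (cycleGraph p □ cycleGraph q).Adj a b) :
    HasPeeling p q ((b.1 - a.1).val, (b.2 - a.2).val) := by
  have key : ∀ {n : ℕ} (x y : Fin n), x ≠ y → ¬ (cycleGraph n).Adj x y →
      2 ≤ (y - x).val ∧ (y - x).val + 2 ≤ n := by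
    intro n x y hxy hadj
    rw [cycleGraph_adj'] at hadj
    rw [ne_eq, Fin.ext_iff] at hxy
    rw [Fin.val_sub_eq_ite] at hadj ⊢
    rw [Fin.val_sub_eq_ite] at hadj
    split_ifs at hadj ⊢ <;> omega
  have hzero : ∀ {n : ℕ} (x y : Fin n), (y - x).val = 0 → x = y := by
    intro n x y hxy
    rw [Fin.val_sub_eq_ite] at hxy
    ext
    split_ifs at hxy <;> omega
  rw [boxProd_adj, not_or] at h
  refine hasPeeling_of_odd hp hq hp3 hq3 (Fin.isLt _) (Fin.isLt _) (fun h0 => ?_) fun h0 => ?_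
  · have e := hzero _ _ h0
    exact key _ _ (fun e' => hab (Prod.ext e e')) fun h' => h.2 ⟨h', e⟩
  · have e := hzero _ _ h0
    exact key _ _ (fun e' => hab (Prod.ext e' e)) fun h' => h.1 ⟨h', e⟩

lemma vdeg_boxProd_cycleGraph {p q : ℕ} (hp : 3 ≤ p) (hq : 3 ≤ q) (v : Fin p × Fin q) :
    vdeg (cycleGraph p □ cycleGraph q) v = 4 := by
  have : NeZero p := ⟨by omega⟩
  have : NeZero q := ⟨by omega⟩
  simpa [vdeg, SimpleGraph.neighborSet] using
    ncard_boxProd_cycleGraph hp hq v (fun _ => True)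

lemma ncard_edgeSet_boxProd_cycleGraph {p q : ℕ} (hp : 3 ≤ p) (hq : 3 ≤ q) :
    (cycleGraph p □ cycleGraph q).edgeSet.ncard = 2 * (p * q) := by
  classical
  have h : ∑ _v : Fin p × Fin q, 4 = 2 * (cycleGraph p □ cycleGraph q).edgeFinset.card := by
    rw [← sum_degrees_eq_twice_card_edges]
    refine Finset.sum_congr rfl fun v _ => ?_
    rw [← vdeg_boxProd_cycleGraph hp hq v, vdeg, Set.ncard_eq_toFinset_card',
      ← SimpleGraph.card_neighborFinset_eq_degree, SimpleGraph.neighborFinset]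
    congr!
  rw [Finset.sum_const, Finset.card_univ, Fintype.card_prod,
    Fintype.card_fin, Fintype.card_fin, smul_eq_mul] at h
  rw [Set.ncard_eq_toFinset_card', ← SimpleGraph.edgeFinset]
  omega

lemma sinkSet_boxProd_cycleGraph {p q : ℕ} (hp : 3 ≤ p) (hq : 3 ≤ q)
    (T : Set (Fin p × Fin q)) : sinkSet (cycleGraph p □ cycleGraph q) T = sourceSet T := by
  ext v
  have h4 : Even 4 := by decide
  simp [sinkSet, sourceSet, vdeg_boxProd_cycleGraph hp hq, h4, ← Nat.not_even_iff_odd]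

/-- Lemma (tori): for `p, q ≥ 4`, the torus `C_p □ C_q` admits an acyclic `T`-odd
orientation for every `T` satisfying `𝒫 𝒮 𝒮̄`. -/
theorem torus_carac (p q : ℕ) (hp : 4 ≤ p) (hq : 4 ≤ q) (T : Set (Fin p × Fin q))
    (hP : CondP (cycleGraph p □ cycleGraph q) T)
    (hS : CondS (cycleGraph p □ cycleGraph q) T)
    (hSbar : CondSbar (cycleGraph p □ cycleGraph q) T) :
    HasAcyclicTOddOrientation (cycleGraph p □ cycleGraph q) T := by
  obtain ⟨⟨a, ha⟩, hS⟩ := hS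
  by_cases heven : Even (p * q)
  · refine hasAcyclicTOddOrientation_of_hasPeeling (by omega) (by omega) hP ha ha ?_
    have : NeZero p := ⟨by omega⟩
    have : NeZero q := ⟨by omega⟩
    simpa using hasPeeling_of_even hp hq heven
  rw [Nat.not_even_iff_odd] at heven
  obtain ⟨hpo, hqo⟩ := Nat.odd_mul.1 heven
  have hcompl : T.ncard + (sourceSet T).ncard = p * q := by
    simpa [sourceSet] using Set.ncard_add_ncard_compl T
  have hT : Even T.ncard := by
    rw [CondP, ncard_edgeSet_boxProd_cycleGraph (by omega) (by omega)] at hP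
    exact (Nat.even_add.1 hP).1 (even_two_mul _)
  have hne : (sourceSet T).ncard ≠ 1 := by
    intro h1
    rcases hS h1 with h | h
    · rw [Nat.card_prod, Nat.card_fin, Nat.card_fin] at h
      nlinarith
    · exact h (sinkSet_boxProd_cycleGraph (by omega) (by omega) T).symm
  have hcard : 2 < (sourceSet T).ncard := by
    rw [← hcompl] at heven
    obtain ⟨k, hk⟩ := (Nat.odd_add'.1 heven).2 hT
    omega
  obtain ⟨x, y, z, hx, hy, hz, hxy, hxz, hyz⟩ := (Set.two_lt_ncard_iff).1 hcard
  have solve : ∀ u ∈ sourceSet T, ∀ v ∈ sourceSet T, u ≠ v →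
      ¬ (cycleGraph p □ cycleGraph q).Adj u v →
      HasAcyclicTOddOrientation (cycleGraph p □ cycleGraph q) T := fun u hu v hv huv hadj =>
    hasAcyclicTOddOrientation_of_hasPeeling (by omega) (by omega) hP hu hv
      (hasPeeling_of_not_adj hpo hqo (by omega) (by omega) huv hadj)
  by_cases h₁ : (cycleGraph p □ cycleGraph q).Adj x y
  · by_cases h₂ : (cycleGraph p □ cycleGraph q).Adj x z
    · exact solve y hy z hz hyz fun h₃ => boxProd_cycleGraph_not_triangle hp hq h₁ h₂ h₃
    · exact solve x hx z hz hxz h₂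
  · exact solve x hx y hy hxy h₁
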